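/- Let N ≥ 1, let a be a real number with −1 < a < 1 and aN < 2, let p > 1 + (2−a)/N, set r_* := N(p−1)/(2−a) > 1, and let 1 ≤ r ≤ r_*. Let Γ : ℝ^N × ℝ^N × (0,∞) → ℝ be a measurable nonnegative kernel satisfying (K1), (K2), and the upper Gaussian-type bound: there exist C₀, c₀ > 0 such that Γ(x,y,t) ≤ C₀ t^{−N/(2−a)} exp(−c₀ (|x−y|^{(2−a)}/t)^{1/(1−a)}) for all x, y ∈ ℝ^N and t > 0. Then there exists δ > 0 such that for every nonnegative φ ∈ L^∞(ℝ^N) ∩ L^r(ℝ^N) with ‖φ‖_r^{r/r_*} · ‖φ‖_∞^{1 − r/r_*} < δ, there exists a global-in-time mild solution u of u_t = div(w∇u) + u^p with kernel Γ and initial data φ, and it satisfies sup_{t>0} (1+t)^{(N/(2−a))(1/r − 1/q)} ‖u(·,t)‖_q < ∞ for every q with r ≤ q ≤ ∞. -/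

import Mathlib

open MeasureTheory Real Set
open scoped ENNReal

noncomputable section

/-- `N`-dimensional Euclidean space. -/
abbrev E (N : ℕ) : Type := EuclideanSpace ℝ (Fin N)

/-- A mild solution of `u_t = div(w ∇u) + u^p` with kernel `Γ` and initial data `φ`
on `ℝ^N × (0,T)` (`T ∈ (0,∞]`): a nonnegative measurable function, essentially bounded
on `ℝ^N × (0,T)`, satisfying the Duhamel integral identity (with all integrals finite). -/
def IsMildSolution (N : ℕ) (p : ℝ) (Γ : E N → E N → ℝ → ℝ)
    (φ : E N → ℝ) (T : ℝ≥0∞) (u : E N → ℝ → ℝ) : Prop :=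
  Measurable (fun q : E N × ℝ => u q.1 q.2) ∧
  (∀ x t, 0 ≤ u x t) ∧
  (∃ M : ℝ, ∀ t : ℝ, 0 < t → ENNReal.ofReal t < T →
    ∀ᵐ x : E N ∂volume, u x t ≤ M) ∧
  (∀ t : ℝ, 0 < t → ENNReal.ofReal t < T →
    ∀ᵐ x : E N ∂volume,
      Integrable (fun y => Γ x y t * φ y) volume ∧
      Integrable (fun q : E N × ℝ => Γ x q.1 (t - q.2) * u q.1 q.2 ^ p)
        (volume.prod (volume.restrict (Ioo (0:ℝ) t))) ∧
      u x t = (∫ y, Γ x y t * φ y) +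
        ∫ s in Ioo (0:ℝ) t, ∫ y, Γ x y (t - s) * u y s ^ p)

/-- The weak `L^r` quasinorm `‖f‖_{r,∞} = sup_{λ>0} λ |{|f|>λ}|^{1/r}`. -/
def weakNorm (N : ℕ) (r : ℝ) (f : E N → ℝ) : ℝ≥0∞ :=
  ⨆ (l : ℝ) (_ : 0 < l), ENNReal.ofReal l * (volume {x : E N | l < |f x|}) ^ (1 / r)

/-- A measurable transition kernel on `X`, Markovian in both variables, satisfying the
Chapman–Kolmogorov identity. -/
structure IsMarkovKernelFlow {X : Type*} [MeasurableSpace X] (μ : Measure X)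
    (G : X → X → ℝ → ℝ≥0∞) : Prop where
  measurable : Measurable fun q : X × X × ℝ => G q.1 q.2.1 q.2.2
  lintegral_left : ∀ y t, 0 < t → ∫⁻ x, G x y t ∂μ = 1
  lintegral_right : ∀ x t, 0 < t → ∫⁻ y, G x y t ∂μ = 1
  chapman_kolmogorov : ∀ x y s t, 0 < s → s < t →
    G x y t = ∫⁻ ξ, G x ξ (t - s) * G ξ y s ∂μ

/-- The action of a kernel on a nonnegative function. -/
def kernelFlow {X : Type*} [MeasurableSpace X] (μ : Measure X)
    (G : X → X → ℝ → ℝ≥0∞) (f : X → ℝ≥0∞) (x : X) (t : ℝ) : ℝ≥0∞ :=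
  ∫⁻ y, G x y t * f y ∂μ

/-- The Duhamel term of a nonnegative space-time source. -/
def duhamelTerm {X : Type*} [MeasurableSpace X] (μ : Measure X)
    (G : X → X → ℝ → ℝ≥0∞) (F : X → ℝ → ℝ≥0∞) (x : X) (t : ℝ) : ℝ≥0∞ :=
  ∫⁻ s in Ioo (0 : ℝ) t, ∫⁻ y, G x y (t - s) * F y s ∂μ

/-- The Picard iterates of `v = S(t) f + ∫₀ᵗ S(t - s) v(s)^p ds`, started at zero. -/
def picardIterate {X : Type*} [MeasurableSpace X] (μ : Measure X)
    (G : X → X → ℝ → ℝ≥0∞) (p : ℝ) (f : X → ℝ≥0∞) : ℕ → X → ℝ → ℝ≥0∞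
  | 0 => fun _ _ => 0
  | n + 1 => fun x t => kernelFlow μ G f x t +
      duhamelTerm μ G (fun y s => picardIterate μ G p f n y s ^ p) x t

lemma lintegral_mul_rpow_le {X : Type*} [MeasurableSpace X] {μ : Measure X}
    {g f : X → ℝ≥0∞} (hg : Measurable g) (hf : Measurable f) (hg1 : ∫⁻ x, g x ∂μ = 1)
    {s : ℝ} (hs : 1 ≤ s) :
    (∫⁻ x, g x * f x ∂μ) ^ s ≤ ∫⁻ x, g x * f x ^ s ∂μ := by
  have : IsProbabilityMeasure (μ.withDensity g) := ⟨by
    rw [withDensity_apply _ MeasurableSet.univ, Measure.restrict_univ, hg1]⟩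
  have h := eLpNorm'_le_eLpNorm'_of_exponent_le (one_pos) hs (μ.withDensity g)
    hf.aestronglyMeasurable
  have hs0 : 0 < s := by linarith
  simp only [eLpNorm'_eq_lintegral_enorm, enorm_eq_self, ENNReal.rpow_one, div_one] at h
  rw [lintegral_withDensity_eq_lintegral_mul _ hg hf,
    lintegral_withDensity_eq_lintegral_mul _ hg (hf.pow_const s)] at h
  rwa [one_div, ENNReal.le_rpow_inv_iff hs0] at h

section Flow

variable {X : Type*} [MeasurableSpace X] {μ : Measure X} {G : X → X → ℝ → ℝ≥0∞}

lemma IsMarkovKernelFlow.kernelFlow_rpow_le (hG : IsMarkovKernelFlow μ G)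
    {f : X → ℝ≥0∞} (hf : Measurable f) (x : X) {t : ℝ} (ht : 0 < t) {s : ℝ} (hs : 1 ≤ s) :
    kernelFlow μ G f x t ^ s ≤ kernelFlow μ G (fun y => f y ^ s) x t :=
  lintegral_mul_rpow_le
    (hG.measurable.comp (by fun_prop : Measurable fun z : X => (x, z, t))) hf
    (hG.lintegral_right x t ht) hs

lemma IsMarkovKernelFlow.kernelFlow_le_of_ae_le (hG : IsMarkovKernelFlow μ G)
    {f : X → ℝ≥0∞} {A : ℝ≥0∞} (hA : ∀ᵐ y ∂μ, f y ≤ A) (x : X) {t : ℝ} (ht : 0 < t) :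
    kernelFlow μ G f x t ≤ A := by
  have hm : Measurable fun z : X => G x z t :=
    hG.measurable.comp (by fun_prop : Measurable fun z : X => (x, z, t))
  calc kernelFlow μ G f x t ≤ ∫⁻ y, G x y t * A ∂μ :=
        lintegral_mono_ae (hA.mono fun y hy => by gcongr)
    _ = A := by rw [lintegral_mul_const _ hm, hG.lintegral_right x t ht, one_mul]

lemma kernelFlow_le_mul_lintegral {f : X → ℝ≥0∞} (hf : Measurable f) {x : X} {t : ℝ}
    {c : ℝ≥0∞} (hc : ∀ y, G x y t ≤ c) :
    kernelFlow μ G f x t ≤ c * ∫⁻ y, f y ∂μ := by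
  rw [← lintegral_const_mul _ hf]
  exact lintegral_mono fun y => by gcongr; exact hc y

lemma duhamelTerm_mono {F H : X → ℝ → ℝ≥0∞} {x : X} {t : ℝ}
    (h : ∀ y s, 0 < s → s < t → F y s ≤ H y s) :
    duhamelTerm μ G F x t ≤ duhamelTerm μ G H x t := by
  refine setLIntegral_mono' measurableSet_Ioo fun s hs => lintegral_mono fun y => ?_
  gcongr
  exact h y s hs.1 hs.2

lemma picardIterate_mono {p : ℝ} (hp : 0 ≤ p) (f : X → ℝ≥0∞) (x : X) (t : ℝ) :
    Monotone fun n => picardIterate μ G p f n x t := by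
  refine monotone_nat_of_le_succ fun n => ?_
  induction n generalizing x t with
  | zero => exact zero_le
  | succ n ih =>
    exact add_le_add le_rfl (duhamelTerm_mono fun y s _ _ =>
      ENNReal.rpow_le_rpow (ih y s) hp)

lemma picardIterate_le {p : ℝ} (hp : 0 ≤ p) {f : X → ℝ≥0∞} {W : X → ℝ → ℝ≥0∞}
    (hW : ∀ x t, 0 < t →
      kernelFlow μ G f x t + duhamelTerm μ G (fun y s => W y s ^ p) x t ≤ W x t)
    (n : ℕ) (x : X) {t : ℝ} (ht : 0 < t) : picardIterate μ G p f n x t ≤ W x t := by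
  induction n generalizing x t with
  | zero => exact zero_le
  | succ n ih =>
    exact (add_le_add le_rfl (duhamelTerm_mono fun y s hs _ =>
      ENNReal.rpow_le_rpow (ih y hs) hp)).trans (hW x t ht)

variable [SFinite μ]

lemma IsMarkovKernelFlow.measurable_kernelFlow (hG : IsMarkovKernelFlow μ G)
    {f : X → ℝ≥0∞} (hf : Measurable f) :
    Measurable fun q : X × ℝ => kernelFlow μ G f q.1 q.2 := by
  have h : Measurable fun q : (X × ℝ) × X => G q.1.1 q.2 q.1.2 * f q.2 :=
    (hG.measurable.comp (by fun_prop : Measurable fun q : (X × ℝ) × X =>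
      (q.1.1, q.2, q.1.2))).mul (hf.comp measurable_snd)
  exact h.lintegral_prod_right'

lemma IsMarkovKernelFlow.measurable_duhamelTerm (hG : IsMarkovKernelFlow μ G)
    {F : X → ℝ → ℝ≥0∞} (hF : Measurable fun q : X × ℝ => F q.1 q.2) :
    Measurable fun q : X × ℝ => duhamelTerm μ G F q.1 q.2 := by
  have h : Measurable fun q : ((X × ℝ) × ℝ) × X =>
      G q.1.1.1 q.2 (q.1.1.2 - q.1.2) * F q.2 q.1.2 :=
    (hG.measurable.comp (by fun_prop : Measurable fun q : ((X × ℝ) × ℝ) × X =>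
      (q.1.1.1, q.2, q.1.1.2 - q.1.2))).mul
      (hF.comp (by fun_prop : Measurable fun q : ((X × ℝ) × ℝ) × X => (q.2, q.1.2)))
  have hS : MeasurableSet {q : (X × ℝ) × ℝ | 0 < q.2 ∧ q.2 < q.1.2} :=
    (measurableSet_lt measurable_const measurable_snd).inter
      (measurableSet_lt measurable_snd (measurable_snd.comp measurable_fst))
  have h2 := (h.lintegral_prod_right' (ν := μ)).indicator hS
  have h3 := h2.lintegral_prod_right' (ν := (volume : Measure ℝ))
  convert h3 using 2 with q
  rw [duhamelTerm, ← lintegral_indicator measurableSet_Ioo]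
  rfl

lemma IsMarkovKernelFlow.kernelFlow_comp (hG : IsMarkovKernelFlow μ G)
    {f : X → ℝ≥0∞} (hf : Measurable f) (x : X) {s t : ℝ} (hs : 0 < s) (hst : s < t) :
    ∫⁻ y, G x y (t - s) * kernelFlow μ G f y s ∂μ = kernelFlow μ G f x t := by
  have hm1 : ∀ y t, Measurable fun z => G y z t := fun y t =>
    hG.measurable.comp (by fun_prop : Measurable fun z : X => (y, z, t))
  have hm2 : ∀ z t, Measurable fun y => G y z t := fun z t =>
    hG.measurable.comp (by fun_prop : Measurable fun y : X => (y, z, t))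
  have hm3 : Measurable fun q : X × X => G q.1 q.2 s :=
    hG.measurable.comp (by fun_prop : Measurable fun q : X × X => (q.1, q.2, s))
  calc ∫⁻ y, G x y (t - s) * kernelFlow μ G f y s ∂μ
      = ∫⁻ y, ∫⁻ z, G x y (t - s) * (G y z s * f z) ∂μ ∂μ := by
        refine lintegral_congr fun y => ?_
        rw [kernelFlow, ← lintegral_const_mul]
        exact (hm1 y s).mul hf
    _ = ∫⁻ z, ∫⁻ y, G x y (t - s) * (G y z s * f z) ∂μ ∂μ := by
        refine lintegral_lintegral_swap (Measurable.aemeasurable ?_)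
        exact ((hm1 x (t - s)).comp measurable_fst).mul (hm3.mul (hf.comp measurable_snd))
    _ = kernelFlow μ G f x t := by
        refine lintegral_congr fun z => ?_
        rw [hG.chapman_kolmogorov x z s t hs hst, ← lintegral_mul_const]
        · simp only [mul_assoc]
        · exact (hm1 x (t - s)).mul (hm2 z s)

lemma IsMarkovKernelFlow.lintegral_kernelFlow (hG : IsMarkovKernelFlow μ G)
    {f : X → ℝ≥0∞} (hf : Measurable f) {t : ℝ} (ht : 0 < t) :
    ∫⁻ x, kernelFlow μ G f x t ∂μ = ∫⁻ y, f y ∂μ := by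
  have hm : Measurable fun q : X × X => G q.1 q.2 t :=
    hG.measurable.comp (by fun_prop : Measurable fun q : X × X => (q.1, q.2, t))
  unfold kernelFlow
  rw [lintegral_lintegral_swap (hm.mul (hf.comp measurable_snd)).aemeasurable]
  refine lintegral_congr fun y => ?_
  rw [lintegral_mul_const, hG.lintegral_left y t ht, one_mul]
  exact hm.comp (by fun_prop : Measurable fun x : X => (x, y))

lemma IsMarkovKernelFlow.measurable_picardIterate (hG : IsMarkovKernelFlow μ G) (p : ℝ)
    {f : X → ℝ≥0∞} (hf : Measurable f) (n : ℕ) :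
    Measurable fun q : X × ℝ => picardIterate μ G p f n q.1 q.2 := by
  induction n with
  | zero => exact measurable_const
  | succ n ih =>
    simp only [picardIterate]
    exact (hG.measurable_kernelFlow hf).add (hG.measurable_duhamelTerm (ih.pow_const p))

/-- A supersolution of the integral equation dominates a solution. -/

lemma IsMarkovKernelFlow.exists_solution_of_supersolution (hG : IsMarkovKernelFlow μ G)
    {p : ℝ} (hp : 0 < p) {f : X → ℝ≥0∞} (hf : Measurable f) {W : X → ℝ → ℝ≥0∞}
    (hW : ∀ x t, 0 < t →
      kernelFlow μ G f x t + duhamelTerm μ G (fun y s => W y s ^ p) x t ≤ W x t) :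
    ∃ V : X → ℝ → ℝ≥0∞, Measurable (fun q : X × ℝ => V q.1 q.2) ∧
      (∀ x t, 0 < t → V x t ≤ W x t) ∧
      ∀ x t, V x t = kernelFlow μ G f x t + duhamelTerm μ G (fun y s => V y s ^ p) x t := by
  have hv := hG.measurable_picardIterate p hf
  have hmono := picardIterate_mono (μ := μ) (G := G) hp.le f
  refine ⟨fun x t => ⨆ n, picardIterate μ G p f n x t, Measurable.iSup hv,
    fun x t ht => iSup_le fun n => picardIterate_le hp.le hW n x ht, fun x t => ?_⟩
  have hpow : ∀ y s, (⨆ n, picardIterate μ G p f n y s) ^ p =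
      ⨆ n, picardIterate μ G p f n y s ^ p := fun y s =>
    (ENNReal.orderIsoRpow p hp).map_iSup _
  have hmp : ∀ y s, Monotone fun n => picardIterate μ G p f n y s ^ p := fun y s m n hmn =>
    ENNReal.rpow_le_rpow (hmono y s hmn) hp.le
  have hm (n : ℕ) : Measurable fun q : ℝ × X =>
      G x q.2 (t - q.1) * picardIterate μ G p f n q.2 q.1 ^ p :=
    (hG.measurable.comp (by fun_prop : Measurable fun q : ℝ × X => (x, q.2, t - q.1))).mul
      (((hv n).comp (by fun_prop : Measurable fun q : ℝ × X => (q.2, q.1))).pow_const p)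
  have hD : duhamelTerm μ G (fun y s => (⨆ n, picardIterate μ G p f n y s) ^ p) x t =
      ⨆ n, duhamelTerm μ G (fun y s => picardIterate μ G p f n y s ^ p) x t := by
    unfold duhamelTerm
    rw [← lintegral_iSup (fun n => (hm n).lintegral_prod_right')]
    · refine lintegral_congr fun s => ?_
      dsimp only
      rw [← lintegral_iSup]
      · refine lintegral_congr fun y => ?_
        rw [hpow, ENNReal.mul_iSup]
      · exact fun n => (hm n).comp measurable_prodMk_left
      · intro m n hmn y
        exact mul_le_mul_right (hmp y s hmn) _
    · intro m n hmn s
      exact lintegral_mono fun y => mul_le_mul_right (hmp y s hmn) _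
  rw [hD, ENNReal.add_iSup]
  exact ((hmono x t).iSup_nat_add 1).symm

/-- If `S(t) f^k` satisfies a pointwise bound `m(t)^k` with `m` small in an integrated sense,
then `2 (S(t) f^k)^{1/k}` is a supersolution. -/

lemma IsMarkovKernelFlow.isSupersolution (hG : IsMarkovKernelFlow μ G)
    {p k : ℝ} (hk : 1 ≤ k) (hkp : k ≤ p) {f : X → ℝ≥0∞} (hf : Measurable f)
    {m : ℝ → ℝ≥0∞} (hm : Measurable m)
    (hle : ∀ x t, 0 < t → kernelFlow μ G (fun y => f y ^ k) x t ^ k⁻¹ ≤ m t)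
    (hsmall : ∀ t, 0 < t →
      2 ^ p * (∫⁻ s in Ioo (0 : ℝ) t, m s ^ (p - k)) * m t ^ (k - 1) ≤ 1)
    (x : X) {t : ℝ} (ht : 0 < t) :
    kernelFlow μ G f x t + duhamelTerm μ G
      (fun y s => (2 * kernelFlow μ G (fun y => f y ^ k) y s ^ k⁻¹) ^ p) x t ≤
      2 * kernelFlow μ G (fun y => f y ^ k) x t ^ k⁻¹ := by
  have hk0 : 0 < k := by linarith
  set U := kernelFlow μ G (fun y => f y ^ k) with hU
  have hUk : ∀ y s, (U y s ^ k⁻¹) ^ k = U y s := fun y s => by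
    rw [← ENNReal.rpow_mul, inv_mul_cancel₀ hk0.ne', ENNReal.rpow_one]
  have h1 : kernelFlow μ G f x t ≤ U x t ^ k⁻¹ := by
    rw [ENNReal.le_rpow_inv_iff hk0]
    exact hG.kernelFlow_rpow_le hf x ht hk
  have hsrc : ∀ y s, 0 < s →
      (2 * U y s ^ k⁻¹) ^ p ≤ (2 ^ p * m s ^ (p - k)) * U y s := by
    intro y s hs
    rw [ENNReal.mul_rpow_of_nonneg _ _ (by linarith), mul_assoc]
    gcongr
    calc (U y s ^ k⁻¹) ^ p = (U y s ^ k⁻¹) ^ (p - k) * (U y s ^ k⁻¹) ^ k := by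
          rw [← ENNReal.rpow_add_of_nonneg _ _ (by linarith) hk0.le, sub_add_cancel]
      _ ≤ m s ^ (p - k) * U y s := by
          rw [hUk]
          gcongr
          exact hle y s hs
  have hUm : ∀ s, Measurable fun y => U y s := fun s =>
    (hG.measurable_kernelFlow (hf.pow_const k)).comp measurable_prodMk_right
  have h2 : duhamelTerm μ G (fun y s => (2 * U y s ^ k⁻¹) ^ p) x t ≤
      (2 ^ p * ∫⁻ s in Ioo (0 : ℝ) t, m s ^ (p - k)) * U x t := by
    calc duhamelTerm μ G (fun y s => (2 * U y s ^ k⁻¹) ^ p) x t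
        ≤ duhamelTerm μ G (fun y s => (2 ^ p * m s ^ (p - k)) * U y s) x t :=
          duhamelTerm_mono fun y s hs _ => hsrc y s hs
      _ = ∫⁻ s in Ioo (0 : ℝ) t, (2 ^ p * m s ^ (p - k)) * U x t := by
          refine setLIntegral_congr_fun measurableSet_Ioo fun s hs => ?_
          have hGm : Measurable fun y => G x y (t - s) :=
            hG.measurable.comp (by fun_prop : Measurable fun z : X => (x, z, t - s))
          simp only [mul_left_comm (G x _ (t - s))]
          rw [lintegral_const_mul _ (by exact hGm.mul (hUm s)),
            hG.kernelFlow_comp (hf.pow_const k) x hs.1 hs.2]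
      _ = _ := by
          rw [lintegral_mul_const _ ((hm.pow_const _).const_mul _),
            lintegral_const_mul _ (hm.pow_const _)]
  have h3 : U x t = U x t ^ k⁻¹ * (U x t ^ k⁻¹) ^ (k - 1) := by
    have h := ENNReal.rpow_add_of_nonneg (x := U x t ^ k⁻¹) 1 (k - 1) zero_le_one (by linarith)
    rwa [add_sub_cancel, hUk, ENNReal.rpow_one] at h
  have h4 : duhamelTerm μ G (fun y s => (2 * U y s ^ k⁻¹) ^ p) x t ≤ U x t ^ k⁻¹ := by
    calc _ ≤ (2 ^ p * ∫⁻ s in Ioo (0 : ℝ) t, m s ^ (p - k)) * U x t := h2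
      _ = (2 ^ p * ∫⁻ s in Ioo (0 : ℝ) t, m s ^ (p - k)) *
          (U x t ^ k⁻¹ * (U x t ^ k⁻¹) ^ (k - 1)) := by rw [← h3]
      _ = (2 ^ p * (∫⁻ s in Ioo (0 : ℝ) t, m s ^ (p - k)) *
          (U x t ^ k⁻¹) ^ (k - 1)) * U x t ^ k⁻¹ := by ring
      _ ≤ (2 ^ p * (∫⁻ s in Ioo (0 : ℝ) t, m s ^ (p - k)) * m t ^ (k - 1)) *
          U x t ^ k⁻¹ := by
          gcongr
          exact hle x t ht
      _ ≤ 1 * U x t ^ k⁻¹ := by gcongr; exact hsmall t ht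
      _ = _ := one_mul _
  rw [two_mul]
  exact add_le_add h1 h4

end Flow

lemma IsMarkovKernelFlow.kernelFlow_rpow_inv_rpow_le {X : Type*} [MeasurableSpace X]
    {μ : Measure X} {G : X → X → ℝ → ℝ≥0∞} (hG : IsMarkovKernelFlow μ G) {f : X → ℝ≥0∞}
    (hf : Measurable f) {k r : ℝ} (hk : 0 < k) (hkr : k ≤ r) (x : X) {t : ℝ} (ht : 0 < t) :
    (kernelFlow μ G (fun y => f y ^ k) x t ^ k⁻¹) ^ r ≤
      kernelFlow μ G (fun y => f y ^ r) x t := by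
  have h := hG.kernelFlow_rpow_le (hf.pow_const k) x ht ((one_le_div hk).2 hkr)
  simp only [← ENNReal.rpow_mul, mul_div_cancel₀ r hk.ne'] at h
  rwa [← ENNReal.rpow_mul, inv_mul_eq_div]

lemma setLIntegral_Ioo_rpow {a t : ℝ} (ha : -1 < a) (ht : 0 < t) :
    ∫⁻ s in Ioo (0 : ℝ) t, ENNReal.ofReal (s ^ a) = ENNReal.ofReal (t ^ (a + 1) / (a + 1)) := by
  have hint : IntegrableOn (fun s : ℝ => s ^ a) (Ioo 0 t) :=
    ((intervalIntegrable_iff_integrableOn_Ioc_of_le ht.le).1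
      (intervalIntegral.intervalIntegrable_rpow' ha)).mono_set Ioo_subset_Ioc_self
  rw [← ofReal_integral_eq_lintegral_ofReal hint
    ((ae_restrict_mem measurableSet_Ioo).mono fun s hs => rpow_nonneg hs.1.le a),
    ← integral_Ioc_eq_integral_Ioo, ← intervalIntegral.integral_of_le ht.le,
    integral_rpow (Or.inl ha), zero_rpow (by linarith), sub_zero]

lemma setLIntegral_Ioi_rpow {a c : ℝ} (ha : a < -1) (hc : 0 < c) :
    ∫⁻ s in Ioi c, ENNReal.ofReal (s ^ a) = ENNReal.ofReal (-c ^ (a + 1) / (a + 1)) := by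
  rw [← ofReal_integral_eq_lintegral_ofReal (integrableOn_Ioi_rpow_of_lt ha hc)
    ((ae_restrict_mem measurableSet_Ioi).mono fun s hs => rpow_nonneg (hc.trans hs).le a),
    integral_Ioi_rpow_of_lt ha hc]

lemma critical_smallness {p k K : ℝ} (hk : 1 < k) (hkp : k ≤ p) (hK : 0 ≤ K)
    (hsmall : 2 ^ p * K ^ (p - 1) * ((p - 1) / (k - 1)) ≤ 1) {t : ℝ} (ht : 0 < t) :
    2 ^ p * (∫⁻ s in Ioo (0 : ℝ) t,
      ENNReal.ofReal (K * s ^ (-(p - 1)⁻¹)) ^ (p - k)) *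
      ENNReal.ofReal (K * t ^ (-(p - 1)⁻¹)) ^ (k - 1) ≤ 1 := by
  have hp1 : 0 < p - 1 := by linarith
  have hk1 : 0 < k - 1 := by linarith
  have hpk : 0 ≤ p - k := by linarith
  have hexp : -(p - 1)⁻¹ * (p - k) + 1 = (k - 1) / (p - 1) := by field_simp; ring
  have hI : ∫⁻ s in Ioo (0 : ℝ) t, ENNReal.ofReal (K * s ^ (-(p - 1)⁻¹)) ^ (p - k) =
      ENNReal.ofReal (K ^ (p - k) * (t ^ ((k - 1) / (p - 1)) / ((k - 1) / (p - 1)))) := by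
    have h1 : ∀ s ∈ Ioo (0 : ℝ) t, ENNReal.ofReal (K * s ^ (-(p - 1)⁻¹)) ^ (p - k) =
        ENNReal.ofReal (K ^ (p - k)) * ENNReal.ofReal (s ^ (-(p - 1)⁻¹ * (p - k))) := by
      intro s hs
      have hs0 := hs.1.le
      rw [ENNReal.ofReal_rpow_of_nonneg (by positivity) hpk, mul_rpow hK (by positivity),
        ← rpow_mul hs0, ENNReal.ofReal_mul (by positivity)]
    rw [setLIntegral_congr_fun measurableSet_Ioo h1,
      lintegral_const_mul _ (by fun_prop), setLIntegral_Ioo_rpow _ ht, hexp,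
      ENNReal.ofReal_mul (by positivity)]
    have : 0 < (k - 1) / (p - 1) := by positivity
    linarith
  have h2 : (2 : ℝ≥0∞) ^ p = ENNReal.ofReal (2 ^ p) := by
    rw [← ENNReal.ofReal_rpow_of_pos two_pos, ENNReal.ofReal_ofNat]
  rw [hI, h2, ENNReal.ofReal_rpow_of_nonneg (by positivity) hk1.le,
    ← ENNReal.ofReal_mul (by positivity), ← ENNReal.ofReal_mul (by positivity)]
  refine ENNReal.ofReal_le_one.2 (le_of_eq_of_le ?_ hsmall)
  have ht2 : t ^ ((k - 1) / (p - 1)) * t ^ (-(p - 1)⁻¹ * (k - 1)) = 1 := by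
    rw [← rpow_add ht]
    convert rpow_zero t using 2
    field_simp
    ring
  have hK2 : K ^ (p - k) * K ^ (k - 1) = K ^ (p - 1) := by
    rw [← rpow_add_of_nonneg hK hpk hk1.le]
    congr 1
    ring
  rw [mul_rpow hK (by positivity), ← rpow_mul ht.le, ← hK2]
  calc _ = 2 ^ p * (K ^ (p - k) * K ^ (k - 1)) * ((p - 1) / (k - 1)) *
        (t ^ ((k - 1) / (p - 1)) * t ^ (-(p - 1)⁻¹ * (k - 1))) := by
        field_simp
    _ = _ := by rw [ht2, mul_one]

lemma subcritical_smallness {p γ A K : ℝ} (hp : 1 < p) (hγ : 0 < γ) (hγp : 1 < γ * (p - 1))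
    (hA : 0 < A) (hK : 0 < K)
    (hsmall : 2 ^ p * (A ^ (p - 1) * (K / A) ^ γ⁻¹ * (1 + (γ * (p - 1) - 1)⁻¹)) ≤ 1) (t : ℝ) :
    2 ^ p * (∫⁻ s in Ioo (0 : ℝ) t,
      ENNReal.ofReal (min A (K * s ^ (-γ))) ^ (p - 1)) ≤ 1 := by
  have hp1 : 0 < p - 1 := by linarith
  set c := (K / A) ^ γ⁻¹ with hc
  have hc0 : 0 < c := by positivity
  have hKc : K * c ^ (-γ) = A := by
    rw [hc, ← rpow_mul (by positivity), inv_mul_eq_div, neg_div, div_self hγ.ne', rpow_neg_one]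
    field_simp
  have hsub : Ioo 0 t ⊆ Ioc 0 c ∪ Ioi c := by
    rw [Ioc_union_Ioi_eq_Ioi hc0.le]
    exact Ioo_subset_Ioi_self
  have h1 : ∫⁻ s in Ioc 0 c, ENNReal.ofReal (min A (K * s ^ (-γ))) ^ (p - 1) ≤
      ENNReal.ofReal (A ^ (p - 1) * c) := by
    calc _ ≤ ∫⁻ _ in Ioc 0 c, ENNReal.ofReal (A ^ (p - 1)) := by
          refine lintegral_mono fun s => ?_
          rw [← ENNReal.ofReal_rpow_of_nonneg hA.le hp1.le]
          gcongr
          exact min_le_left _ _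
      _ = _ := by
          rw [setLIntegral_const, Real.volume_Ioc, sub_zero, ENNReal.ofReal_mul (by positivity)]
  have h2 : ∫⁻ s in Ioi c, ENNReal.ofReal (min A (K * s ^ (-γ))) ^ (p - 1) ≤
      ENNReal.ofReal (A ^ (p - 1) * c * (γ * (p - 1) - 1)⁻¹) := by
    calc _ ≤ ∫⁻ s in Ioi c, ENNReal.ofReal (K ^ (p - 1)) *
            ENNReal.ofReal (s ^ (-γ * (p - 1))) := by
          refine setLIntegral_mono' measurableSet_Ioi fun s hs => ?_
          have hs0 : 0 < s := hc0.trans hs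
          rw [← ENNReal.ofReal_mul (by positivity), rpow_mul hs0.le,
            ← mul_rpow hK.le (by positivity),
            ← ENNReal.ofReal_rpow_of_nonneg (by positivity) hp1.le]
          gcongr
          exact min_le_right _ _
      _ = _ := by
          rw [lintegral_const_mul _ (by fun_prop), setLIntegral_Ioi_rpow (by linarith) hc0,
            ← ENNReal.ofReal_mul (by positivity)]
          congr 1
          have hAK : A ^ (p - 1) = K ^ (p - 1) * c ^ (-γ * (p - 1)) := by
            rw [← hKc, mul_rpow hK.le (by positivity), ← rpow_mul hc0.le]
          rw [hAK, rpow_add hc0, rpow_one,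
            show -γ * (p - 1) + 1 = -(γ * (p - 1) - 1) by ring, neg_div_neg_eq]
          ring
  have h3 : (2 : ℝ≥0∞) ^ p = ENNReal.ofReal (2 ^ p) := by
    rw [← ENNReal.ofReal_rpow_of_pos two_pos, ENNReal.ofReal_ofNat]
  have hpos : 0 < γ * (p - 1) - 1 := by linarith
  calc _ ≤ 2 ^ p * (∫⁻ s in Ioc 0 c ∪ Ioi c,
        ENNReal.ofReal (min A (K * s ^ (-γ))) ^ (p - 1)) := by
        gcongr
    _ ≤ 2 ^ p * (ENNReal.ofReal (A ^ (p - 1) * c) +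
        ENNReal.ofReal (A ^ (p - 1) * c * (γ * (p - 1) - 1)⁻¹)) := by
        gcongr
        exact (lintegral_union_le _ _ _).trans (add_le_add h1 h2)
    _ ≤ 1 := by
        rw [← ENNReal.ofReal_add (by positivity) (by positivity), h3,
          ← ENNReal.ofReal_mul (by positivity), ENNReal.ofReal_le_one]
        refine le_of_eq_of_le ?_ hsmall
        ring

lemma min_mul_rpow_le_one_add_rpow {A K γ : ℝ} (hA : 0 ≤ A) (hγ : 0 ≤ γ)
    {t : ℝ} (ht : 0 < t) :
    min A (K * t ^ (-γ)) ≤ max A K * 2 ^ γ * (1 + t) ^ (-γ) := by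
  have hM : 0 ≤ max A K := hA.trans (le_max_left _ _)
  have key : ∀ {b : ℝ}, 0 < b → 1 + t ≤ 2 * b → b ^ (-γ) ≤ 2 ^ γ * (1 + t) ^ (-γ) := by
    intro b hb hbt
    calc b ^ (-γ) = 2 ^ γ * (2 * b) ^ (-γ) := by
          rw [mul_rpow two_pos.le hb.le, ← mul_assoc, ← rpow_add two_pos, add_neg_cancel,
            rpow_zero, one_mul]
      _ ≤ _ := by
          gcongr ?_ * ?_
          exact rpow_le_rpow_of_nonpos (by positivity) hbt (by linarith)
  rw [mul_assoc]
  rcases le_total t 1 with h | h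
  · have := key one_pos (by linarith)
    rw [one_rpow] at this
    calc _ ≤ A := min_le_left _ _
      _ ≤ max A K * 1 := by rw [mul_one]; exact le_max_left _ _
      _ ≤ _ := by gcongr
  · calc _ ≤ K * t ^ (-γ) := min_le_right _ _
      _ ≤ max A K * (2 ^ γ * (1 + t) ^ (-γ)) := by
          gcongr
          · exact le_max_right _ _
          · exact key ht (by linarith)

/-- Interpolation between an `L^r` bound and a decaying `L^∞` bound. -/
lemma exists_decay_of_le_decay {X : Type*} [MeasurableSpace X] {μ : Measure X} {r κ C : ℝ}
    (hr : 1 ≤ r) (hC : 0 ≤ C) {I : ℝ≥0∞} (hI : I ≠ ⊤) {w : X → ℝ → ℝ}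
    (hle : ∀ x t, 0 < t → ‖w x t‖ₑ ≤ ENNReal.ofReal (C * (1 + t) ^ (-(κ / r))))
    (hint : ∀ t, 0 < t → ∫⁻ x, ‖w x t‖ₑ ^ r ∂μ ≤ I)
    (q : ℝ≥0∞) (hq : ENNReal.ofReal r ≤ q) :
    ∃ D : ℝ≥0∞, D ≠ ⊤ ∧ ∀ t : ℝ, 0 < t →
      ENNReal.ofReal ((1 + t) ^ (κ * (1 / r - q⁻¹.toReal))) *
        eLpNorm (fun x => w x t) q μ ≤ D := by
  have hr0 : 0 < r := by linarith
  rcases eq_or_ne q ⊤ with rfl | hqt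
  · refine ⟨ENNReal.ofReal C, ENNReal.ofReal_ne_top, fun t ht => ?_⟩
    have h1t : 0 < 1 + t := by linarith
    calc _ ≤ ENNReal.ofReal ((1 + t) ^ (κ * (1 / r - (⊤ : ℝ≥0∞)⁻¹.toReal))) *
          ENNReal.ofReal (C * (1 + t) ^ (-(κ / r))) := by
          gcongr
          rw [eLpNorm_exponent_top]
          exact essSup_le_of_ae_le _ (Filter.Eventually.of_forall fun x => hle x t ht)
      _ = ENNReal.ofReal C := by
          rw [← ENNReal.ofReal_mul (by positivity), mul_left_comm, ← rpow_add h1t]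
          simp [div_eq_mul_inv]
  · have hrq : r ≤ q.toReal := (ENNReal.ofReal_le_iff_le_toReal hqt).1 hq
    set σ := q.toReal with hσ
    have hσ0 : 0 < σ := by linarith
    have hq0 : q ≠ 0 := fun h => by simp [hσ, h] at hσ0
    refine ⟨(ENNReal.ofReal (C ^ (σ - r)) * I) ^ (1 / σ), ?_, fun t ht => ?_⟩
    · exact ENNReal.rpow_ne_top_of_nonneg (by positivity)
        (ENNReal.mul_ne_top ENNReal.ofReal_ne_top hI)
    have h1t : 0 < 1 + t := by linarith
    have hbase : 0 ≤ C * (1 + t) ^ (-(κ / r)) := by positivity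
    have hI2 : ∫⁻ x, ‖w x t‖ₑ ^ σ ∂μ ≤
        ENNReal.ofReal ((C * (1 + t) ^ (-(κ / r))) ^ (σ - r)) * I := by
      calc _ ≤ ∫⁻ x, ENNReal.ofReal ((C * (1 + t) ^ (-(κ / r))) ^ (σ - r)) *
            ‖w x t‖ₑ ^ r ∂μ := by
            refine lintegral_mono fun x => ?_
            have h := ENNReal.rpow_add_of_nonneg (x := ‖w x t‖ₑ) (σ - r) r (by linarith) hr0.le
            rw [sub_add_cancel] at h
            rw [h, ← ENNReal.ofReal_rpow_of_nonneg hbase (by linarith)]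
            gcongr
            exact hle x t ht
        _ = ENNReal.ofReal ((C * (1 + t) ^ (-(κ / r))) ^ (σ - r)) * ∫⁻ x, ‖w x t‖ₑ ^ r ∂μ :=
            lintegral_const_mul' _ _ ENNReal.ofReal_ne_top
        _ ≤ _ := by gcongr; exact hint t ht
    rw [eLpNorm_eq_lintegral_rpow_enorm_toReal hq0 hqt, ← hσ, ENNReal.toReal_inv, ← hσ]
    have hw : ENNReal.ofReal ((1 + t) ^ (κ * (1 / r - σ⁻¹))) =
        ENNReal.ofReal ((1 + t) ^ (κ / r * (σ - r))) ^ (1 / σ) := by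
      rw [ENNReal.ofReal_rpow_of_nonneg (by positivity) (by positivity), ← rpow_mul h1t.le]
      congr 2
      field_simp
    rw [hw, ← ENNReal.mul_rpow_of_nonneg _ _ (by positivity)]
    refine ENNReal.rpow_le_rpow ((mul_le_mul_right hI2 _).trans_eq ?_) (by positivity)
    rw [← mul_assoc, ← ENNReal.ofReal_mul (by positivity)]
    congr 2
    rw [mul_rpow hC (by positivity), ← rpow_mul h1t.le, mul_left_comm, ← rpow_add h1t]
    simp

/-- Existence, pointwise majorant and decay once the pointwise bound on the linear flow is small
in the integrated sense required of a supersolution. -/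
lemma exists_mildSolution_of_small {N : ℕ} {p β r k C₀ : ℝ} {Γ : E N → E N → ℝ → ℝ}
    (hΓmeas : Measurable fun q : E N × E N × ℝ => Γ q.1 q.2.1 q.2.2)
    (hΓnonneg : ∀ x y : E N, ∀ t : ℝ, 0 < t → 0 ≤ Γ x y t)
    (hG : IsMarkovKernelFlow volume fun x y t => ENNReal.ofReal (Γ x y t))
    (hC₀ : 0 < C₀) (hΓle : ∀ x y t, 0 < t → Γ x y t ≤ C₀ * t ^ (-β)) (hβ : 0 < β)
    (hk : 1 ≤ k) (hkp : k ≤ p) (hkr : k ≤ r) {φ : E N → ℝ} (hφ : Measurable φ)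
    (hφ0 : ∀ x, 0 ≤ φ x) (hφtop : eLpNorm φ ⊤ volume ≠ ⊤)
    (hφr : eLpNorm φ (ENNReal.ofReal r) volume ≠ ⊤) {m : ℝ → ℝ≥0∞} (hm : Measurable m)
    (hmle : ∀ t, 0 < t → ENNReal.ofReal (min (eLpNorm φ ⊤ volume).toReal
      (C₀ ^ (1 / r) * (eLpNorm φ (ENNReal.ofReal r) volume).toReal * t ^ (-(β / r)))) ≤ m t)
    (hsmall : ∀ t, 0 < t →
      2 ^ p * (∫⁻ s in Ioo (0 : ℝ) t, m s ^ (p - k)) * m t ^ (k - 1) ≤ 1) :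
    ∃ u : E N → ℝ → ℝ, IsMildSolution N p Γ φ ⊤ u ∧
      ∀ q : ℝ≥0∞, ENNReal.ofReal r ≤ q → ∃ C : ℝ≥0∞, C ≠ ⊤ ∧ ∀ t : ℝ, 0 < t →
        ENNReal.ofReal ((1 + t) ^ (β * (1 / r - q⁻¹.toReal))) *
          eLpNorm (fun x => u x t) q volume ≤ C := by
  set A := (eLpNorm φ ⊤ volume).toReal with hA
  set B := (eLpNorm φ (ENNReal.ofReal r) volume).toReal with hB
  have hA0 : 0 ≤ A := ENNReal.toReal_nonneg
  have hB0 : 0 ≤ B := ENNReal.toReal_nonneg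
  have hr1 : 1 ≤ r := hk.trans hkr
  have hr0 : 0 < r := by linarith
  have hk0 : 0 < k := by linarith
  have hp0 : 0 < p := by linarith
  set K := C₀ ^ (1 / r) * B with hK
  have hK0 : 0 ≤ K := by positivity
  set f : E N → ℝ≥0∞ := fun y => ENNReal.ofReal (φ y) with hf
  have hfm : Measurable f := hφ.ennreal_ofReal
  have hfe : ∀ y, f y = ‖φ y‖ₑ := fun y => (Real.enorm_eq_ofReal (hφ0 y)).symm
  have hfA : ∀ᵐ y, f y ≤ ENNReal.ofReal A := by
    rw [hA, ENNReal.ofReal_toReal hφtop, eLpNorm_exponent_top]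
    filter_upwards [ae_le_eLpNormEssSup (f := φ) (μ := volume)] with y hy
    rwa [hfe]
  have hfB : ∫⁻ y, f y ^ r = ENNReal.ofReal (B ^ r) := by
    rw [← ENNReal.ofReal_rpow_of_nonneg hB0 hr0.le, hB, ENNReal.ofReal_toReal hφr,
      eLpNorm_eq_lintegral_rpow_enorm_toReal (by simpa using hr0) ENNReal.ofReal_ne_top,
      ENNReal.toReal_ofReal hr0.le, ← ENNReal.rpow_mul, one_div_mul_cancel hr0.ne',
      ENNReal.rpow_one]
    simp only [hfe]
  set G : E N → E N → ℝ → ℝ≥0∞ := fun x y t => ENNReal.ofReal (Γ x y t) with hGdef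
  set U := kernelFlow volume G (fun y => f y ^ k) with hU
  have hUmin : ∀ x t, 0 < t → U x t ^ k⁻¹ ≤ ENNReal.ofReal (min A (K * t ^ (-(β / r)))) := by
    intro x t ht
    rw [ENNReal.ofReal_min]
    refine le_min ?_ ?_
    · rw [ENNReal.rpow_inv_le_iff hk0]
      exact hG.kernelFlow_le_of_ae_le
        (hfA.mono fun y hy => ENNReal.rpow_le_rpow hy hk0.le) x ht
    · have h1 := hG.kernelFlow_rpow_inv_rpow_le hfm hk0 hkr x ht
      have h2 : kernelFlow volume G (fun y => f y ^ r) x t ≤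
          ENNReal.ofReal (C₀ * t ^ (-β)) * ENNReal.ofReal (B ^ r) := by
        rw [← hfB]
        exact kernelFlow_le_mul_lintegral (hfm.pow_const r)
          fun y => ENNReal.ofReal_le_ofReal (hΓle x y t ht)
      rw [← ENNReal.rpow_le_rpow_iff hr0]
      refine (h1.trans h2).trans_eq ?_
      rw [← ENNReal.ofReal_mul (by positivity),
        ENNReal.ofReal_rpow_of_nonneg (by positivity) hr0.le, hK,
        mul_rpow (by positivity) (by positivity), mul_rpow (by positivity) hB0,
        ← rpow_mul hC₀.le, ← rpow_mul ht.le, one_div_mul_cancel hr0.ne', rpow_one, neg_mul,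
        div_mul_cancel₀ _ hr0.ne']
      congr 1
      ring
  obtain ⟨V, hVm, hVle, hVeq⟩ := hG.exists_solution_of_supersolution hp0 hfm
    fun x t ht => hG.isSupersolution hk hkp hfm hm
      (fun x t ht => (hUmin x t ht).trans (hmle t ht)) hsmall x ht
  have hVmin : ∀ x t, 0 < t →
      V x t ≤ ENNReal.ofReal (2 * min A (K * t ^ (-(β / r)))) := by
    intro x t ht
    rw [ENNReal.ofReal_mul two_pos.le, ENNReal.ofReal_ofNat]
    refine (hVle x t ht).trans ?_
    gcongr
    exact hUmin x t ht
  have hVtop : ∀ x t, 0 < t → V x t ≠ ⊤ := fun x t ht =>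
    ((hVmin x t ht).trans_lt ENNReal.ofReal_lt_top).ne
  have hVe : ∀ x t, 0 < t → ‖(V x t).toReal‖ₑ = V x t := fun x t ht => by
    rw [Real.enorm_eq_ofReal ENNReal.toReal_nonneg, ENNReal.ofReal_toReal (hVtop x t ht)]
  have hum : Measurable fun q : E N × ℝ => (V q.1 q.2).toReal := hVm.ennreal_toReal
  refine ⟨fun x t => (V x t).toReal, ⟨hum, fun _ _ => ENNReal.toReal_nonneg,
    ⟨2 * A, fun t ht _ => Filter.Eventually.of_forall fun x => ?_⟩,
    fun t ht _ => Filter.Eventually.of_forall fun x => ?_⟩, ?_⟩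
  · refine ENNReal.toReal_le_of_le_ofReal (by positivity) ((hVmin x t ht).trans ?_)
    gcongr
    exact min_le_left _ _
  · have hΓx (t : ℝ) : Measurable fun y => Γ x y t :=
      hΓmeas.comp (by fun_prop : Measurable fun y : E N => (x, y, t))
    have hlin : ∀ y, ENNReal.ofReal (Γ x y t * φ y) = G x y t * f y := fun y =>
      ENNReal.ofReal_mul (hΓnonneg x y t ht)
    have hsrc : ∀ s ∈ Ioo (0 : ℝ) t, ∀ y, ENNReal.ofReal (Γ x y (t - s) * (V y s).toReal ^ p) =
        G x y (t - s) * V y s ^ p := fun s hs y => by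
      rw [ENNReal.ofReal_mul (hΓnonneg x y _ (sub_pos.2 hs.2)),
        ← ENNReal.ofReal_rpow_of_nonneg ENNReal.toReal_nonneg hp0.le,
        ENNReal.ofReal_toReal (hVtop y s hs.1)]
    have hsum := hVeq x t
    have hfin := hVtop x t ht
    rw [hsum, ENNReal.add_ne_top] at hfin
    have hmeas2 : Measurable fun q : E N × ℝ => Γ x q.1 (t - q.2) * (V q.1 q.2).toReal ^ p :=
      (hΓmeas.comp (by fun_prop : Measurable fun q : E N × ℝ => (x, q.1, t - q.2))).mul
        (hum.pow_const p)
    have hD : ∫⁻ q, ENNReal.ofReal (Γ x q.1 (t - q.2) * (V q.1 q.2).toReal ^ p)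
        ∂((volume : Measure (E N)).prod (volume.restrict (Ioo (0 : ℝ) t))) =
        duhamelTerm volume G (fun y s => V y s ^ p) x t := by
      rw [lintegral_prod_symm _ hmeas2.ennreal_ofReal.aemeasurable]
      exact setLIntegral_congr_fun measurableSet_Ioo fun s hs => lintegral_congr (hsrc s hs)
    have hnonneg2 : 0 ≤ᵐ[(volume : Measure (E N)).prod (volume.restrict (Ioo (0 : ℝ) t))]
        fun q => Γ x q.1 (t - q.2) * (V q.1 q.2).toReal ^ p := by
      have hmem : ∀ᵐ q ∂((volume : Measure (E N)).prod (volume.restrict (Ioo (0 : ℝ) t))),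
          q.2 ∈ Ioo (0 : ℝ) t :=
        Measure.quasiMeasurePreserving_snd.ae (ae_restrict_mem measurableSet_Ioo)
      filter_upwards [hmem] with q hq
      exact mul_nonneg (hΓnonneg x _ _ (sub_pos.2 hq.2)) (rpow_nonneg ENNReal.toReal_nonneg p)
    have hint2 : Integrable (fun q : E N × ℝ => Γ x q.1 (t - q.2) * (V q.1 q.2).toReal ^ p)
        (volume.prod (volume.restrict (Ioo (0 : ℝ) t))) := by
      refine ⟨hmeas2.aestronglyMeasurable, ?_⟩
      rw [hasFiniteIntegral_iff_ofReal hnonneg2, hD]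
      exact hfin.2.lt_top
    have hnonneg1 : 0 ≤ᵐ[volume] fun y => Γ x y t * φ y :=
      Filter.Eventually.of_forall fun y => mul_nonneg (hΓnonneg x y t ht) (hφ0 y)
    have hS : ∫⁻ y, ENNReal.ofReal (Γ x y t * φ y) = kernelFlow volume G f x t :=
      lintegral_congr hlin
    have hmeas1 : Measurable fun y => Γ x y t * φ y := (hΓx t).mul hφ
    refine ⟨⟨hmeas1.aestronglyMeasurable, ?_⟩, hint2, ?_⟩
    · rw [hasFiniteIntegral_iff_ofReal hnonneg1, hS]
      exact hfin.1.lt_top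
    · rw [← integral_prod_symm _ hint2,
        integral_eq_lintegral_of_nonneg_ae hnonneg1 hmeas1.aestronglyMeasurable,
        integral_eq_lintegral_of_nonneg_ae hnonneg2 hmeas2.aestronglyMeasurable, hD, hS,
        ← ENNReal.toReal_add hfin.1 hfin.2, ← hsum]
  · refine exists_decay_of_le_decay (r := r) (κ := β) (C := 2 * (max A K * 2 ^ (β / r)))
      (I := 2 ^ r * ENNReal.ofReal (B ^ r)) hr1 (by positivity) ?_ ?_ ?_
    · exact ENNReal.mul_ne_top (ENNReal.rpow_ne_top_of_nonneg hr0.le ENNReal.ofNat_ne_top)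
        ENNReal.ofReal_ne_top
    · intro x t ht
      rw [hVe x t ht, mul_assoc]
      refine (hVmin x t ht).trans ?_
      gcongr
      exact min_mul_rpow_le_one_add_rpow hA0 (by positivity) ht
    · intro t ht
      calc ∫⁻ x, ‖(V x t).toReal‖ₑ ^ r
          ≤ ∫⁻ x, 2 ^ r * kernelFlow volume G (fun y => f y ^ r) x t := by
            refine lintegral_mono fun x => ?_
            rw [hVe x t ht]
            calc V x t ^ r ≤ (2 * U x t ^ k⁻¹) ^ r := ENNReal.rpow_le_rpow (hVle x t ht) hr0.le
              _ = 2 ^ r * (U x t ^ k⁻¹) ^ r := ENNReal.mul_rpow_of_nonneg _ _ hr0.le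
              _ ≤ _ := by
                gcongr
                exact hG.kernelFlow_rpow_inv_rpow_le hfm hk0 hkr x ht
        _ = 2 ^ r * ENNReal.ofReal (B ^ r) := by
            rw [lintegral_const_mul' _ _
              (ENNReal.rpow_ne_top_of_nonneg hr0.le ENNReal.ofNat_ne_top),
              hG.lintegral_kernelFlow (hfm.pow_const r) ht, hfB]

lemma isMarkovKernelFlow_ofReal {N : ℕ} {Γ : E N → E N → ℝ → ℝ}
    (hΓmeas : Measurable fun q : E N × E N × ℝ => Γ q.1 q.2.1 q.2.2)
    (hΓnonneg : ∀ x y : E N, ∀ t : ℝ, 0 < t → 0 ≤ Γ x y t)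
    (hK1x : ∀ y : E N, ∀ t : ℝ, 0 < t → ∫ x : E N, Γ x y t = 1)
    (hK1y : ∀ x : E N, ∀ t : ℝ, 0 < t → ∫ y : E N, Γ x y t = 1)
    (hK2 : ∀ x y : E N, ∀ s t : ℝ, 0 < s → s < t →
      Γ x y t = ∫ ξ : E N, Γ x ξ (t - s) * Γ ξ y s)
    (hbdd : ∀ t, 0 < t → ∃ c, ∀ x y, Γ x y t ≤ c) :
    IsMarkovKernelFlow volume fun x y t => ENNReal.ofReal (Γ x y t) where
  measurable := hΓmeas.ennreal_ofReal
  lintegral_left y t ht := by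
    rw [← ofReal_integral_eq_lintegral_ofReal (integrable_of_integral_eq_one (hK1x y t ht))
      (Filter.Eventually.of_forall fun x => hΓnonneg x y t ht), hK1x y t ht, ENNReal.ofReal_one]
  lintegral_right x t ht := by
    rw [← ofReal_integral_eq_lintegral_ofReal (integrable_of_integral_eq_one (hK1y x t ht))
      (Filter.Eventually.of_forall fun y => hΓnonneg x y t ht), hK1y x t ht, ENNReal.ofReal_one]
  chapman_kolmogorov x y s t hs hst := by
    have hts : 0 < t - s := sub_pos.2 hst
    obtain ⟨c, hc⟩ := hbdd s hs
    have hm : Measurable fun ξ => Γ ξ y s :=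
      hΓmeas.comp (by fun_prop : Measurable fun ξ : E N => (ξ, y, s))
    have hint : Integrable fun ξ => Γ x ξ (t - s) * Γ ξ y s :=
      (integrable_of_integral_eq_one (hK1y x _ hts)).mul_bdd (c := c) hm.aestronglyMeasurable
        (Filter.Eventually.of_forall fun ξ => by
          rw [Real.norm_of_nonneg (hΓnonneg ξ y s hs)]; exact hc ξ y)
    rw [hK2 x y s t hs hst, ofReal_integral_eq_lintegral_ofReal hint
      (Filter.Eventually.of_forall fun ξ =>
        mul_nonneg (hΓnonneg x ξ _ hts) (hΓnonneg ξ y s hs))]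
    exact lintegral_congr fun ξ => ENNReal.ofReal_mul (hΓnonneg x ξ _ hts)

lemma exists_pos_mul_rpow_le_one {M e : ℝ} (hM : 0 < M) (he : 0 < e) :
    ∃ δ : ℝ, 0 < δ ∧ ∀ x, 0 ≤ x → x ≤ δ → M * x ^ e ≤ 1 := by
  refine ⟨M⁻¹ ^ e⁻¹, by positivity, fun x hx hxδ => ?_⟩
  calc M * x ^ e ≤ M * (M⁻¹ ^ e⁻¹) ^ e := by gcongr
    _ = 1 := by
      rw [← rpow_mul (by positivity), inv_mul_cancel₀ he.ne', rpow_one, mul_inv_cancel₀ hM.ne']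

/-- Theorem 1.3(ii): global existence for data small in the interpolated
`L^r`–`L^∞` sense, for any nonnegative kernel satisfying (K1), (K2) and the
upper Gaussian-type bound, with the decay estimate in `L^q` for `r ≤ q ≤ ∞`. -/
theorem global_existence_Lp_line_weight
    (N : ℕ) (hN : 1 ≤ N) (a : ℝ) (ha1 : -1 < a) (ha2 : a < 1) (haN : a * N < 2)
    (p : ℝ) (hp : 1 + (2 - a) / N < p)
    (rs : ℝ) (hrs : rs = N * (p - 1) / (2 - a))
    (r : ℝ) (hr1 : 1 ≤ r) (hr2 : r ≤ rs)
    (Γ : E N → E N → ℝ → ℝ)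
    (hΓmeas : Measurable (fun q : E N × E N × ℝ => Γ q.1 q.2.1 q.2.2))
    (hΓnonneg : ∀ x y : E N, ∀ t : ℝ, 0 < t → 0 ≤ Γ x y t)
    (hK1x : ∀ y : E N, ∀ t : ℝ, 0 < t → ∫ x : E N, Γ x y t = 1)
    (hK1y : ∀ x : E N, ∀ t : ℝ, 0 < t → ∫ y : E N, Γ x y t = 1)
    (hK2 : ∀ x y : E N, ∀ s t : ℝ, 0 < s → s < t →
      Γ x y t = ∫ ξ : E N, Γ x ξ (t - s) * Γ ξ y s)
    (hupp : ∃ C₀ c₀ : ℝ, 0 < C₀ ∧ 0 < c₀ ∧ ∀ x y : E N, ∀ t : ℝ, 0 < t →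
      Γ x y t ≤ C₀ * t ^ (-(N : ℝ) / (2 - a)) *
        Real.exp (-c₀ * (‖x - y‖ ^ (2 - a) / t) ^ (1 / (1 - a)))) :
    ∃ δ : ℝ, 0 < δ ∧ ∀ φ : E N → ℝ, Measurable φ → (∀ x, 0 ≤ φ x) →
      eLpNorm φ ⊤ volume ≠ ⊤ → eLpNorm φ (ENNReal.ofReal r) volume ≠ ⊤ →
      (eLpNorm φ (ENNReal.ofReal r) volume) ^ (r / rs) *
        (eLpNorm φ ⊤ volume) ^ (1 - r / rs) < ENNReal.ofReal δ →
      ∃ u : E N → ℝ → ℝ, IsMildSolution N p Γ φ ⊤ u ∧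
        ∀ q : ℝ≥0∞, ENNReal.ofReal r ≤ q → ∃ C : ℝ≥0∞, C ≠ ⊤ ∧ ∀ t : ℝ, 0 < t →
          ENNReal.ofReal ((1 + t) ^ ((N : ℝ) / (2 - a) * (1 / r - q⁻¹.toReal))) *
            eLpNorm (fun x => u x t) q volume ≤ C := by
  obtain ⟨C₀, c₀, hC₀, hc₀, hup⟩ := hupp
  have hNpos : (0 : ℝ) < N := by exact_mod_cast hN
  have h2a : 0 < 2 - a := by linarith
  set β : ℝ := N / (2 - a) with hβ
  have hβ0 : 0 < β := by positivity
  have hp1 : 1 < p := by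
    have : 0 < (2 - a) / N := by positivity
    linarith
  have hp10 : 0 < p - 1 := by linarith
  have hrsβ : rs = β * (p - 1) := by rw [hrs, hβ]; ring
  have hr0 : 0 < r := by linarith
  have hrs0 : 0 < rs := by linarith
  have hΓle : ∀ x y t, 0 < t → Γ x y t ≤ C₀ * t ^ (-β) := by
    intro x y t ht
    refine (hup x y t ht).trans ?_
    rw [hβ, ← neg_div]
    refine mul_le_of_le_one_right (by positivity) (Real.exp_le_one_iff.2 ?_)
    rw [neg_mul, neg_nonpos]
    positivity
  have hG := isMarkovKernelFlow_ofReal hΓmeas hΓnonneg hK1x hK1y hK2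
    fun t ht => ⟨_, fun x y => hΓle x y t ht⟩
  have hreal : ∀ {P Q : ℝ≥0∞} {δ : ℝ}, 0 < δ → P ^ (r / rs) * Q ^ (1 - r / rs) <
      ENNReal.ofReal δ → P.toReal ^ (r / rs) * Q.toReal ^ (1 - r / rs) ≤ δ := by
    intro P Q δ hδ h
    rw [ENNReal.toReal_rpow, ENNReal.toReal_rpow, ← ENNReal.toReal_mul]
    exact ENNReal.toReal_le_of_le_ofReal hδ.le h.le
  rcases hr2.eq_or_lt with hrr | hrr
  · -- critical exponent: compare with a power of the flow of `φ ^ k`, `k > 1`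
    have hr1' : 1 < r := by
      rw [hrr, hrs, lt_div_iff₀ h2a, one_mul]
      rw [← lt_sub_iff_add_lt', div_lt_iff₀ hNpos] at hp
      linarith
    set k := min p r with hk
    have hk1 : 1 < k := lt_min hp1 hr1'
    have hk10 : 0 < k - 1 := by linarith
    obtain ⟨δ, hδ, hδle⟩ := exists_pos_mul_rpow_le_one
      (M := 2 ^ p * (C₀ ^ (1 / r)) ^ (p - 1) * ((p - 1) / (k - 1))) (by positivity) hp10
    refine ⟨δ, hδ, fun φ hφ hφ0 hφtop hφr hsm => ?_⟩
    have hB := hreal hδ hsm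
    rw [← hrr, div_self hr0.ne', sub_self, rpow_zero, mul_one, rpow_one] at hB
    have hγ : β / r = (p - 1)⁻¹ := by rw [hrr, hrsβ]; field_simp
    refine exists_mildSolution_of_small hΓmeas hΓnonneg hG hC₀ hΓle hβ0 hk1.le (min_le_left _ _)
      (min_le_right _ _) hφ hφ0 hφtop hφr
      (m := fun t => ENNReal.ofReal (C₀ ^ (1 / r) *
        (eLpNorm φ (ENNReal.ofReal r) volume).toReal * t ^ (-(p - 1)⁻¹))) (by fun_prop)
      (fun t _ => ENNReal.ofReal_le_ofReal (by rw [hγ]; exact min_le_right _ _))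
      fun t ht => critical_smallness hk1 (min_le_left _ _) (by positivity) ?_ ht
    rw [mul_rpow (by positivity) ENNReal.toReal_nonneg]
    refine le_of_eq_of_le ?_ (hδle _ ENNReal.toReal_nonneg hB)
    ring
  · -- subcritical exponent: compare with the linear flow itself
    have hγp : 1 < β / r * (p - 1) := by
      rw [div_mul_eq_mul_div, ← hrsβ, one_lt_div hr0]
      exact hrr
    have hγp0 : 0 < β / r * (p - 1) - 1 := by linarith
    obtain ⟨δ, hδ, hδle⟩ := exists_pos_mul_rpow_le_one
      (M := 2 ^ p * (C₀ ^ (1 / β) * (1 + (β / r * (p - 1) - 1)⁻¹))) (by positivity) hp10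
    refine ⟨δ, hδ, fun φ hφ hφ0 hφtop hφr hsm => ?_⟩
    have hAB := hreal hδ hsm
    refine exists_mildSolution_of_small hΓmeas hΓnonneg hG hC₀ hΓle hβ0 le_rfl hp1.le
      hr1 hφ hφ0 hφtop hφr (m := fun t => ENNReal.ofReal (min (eLpNorm φ ⊤ volume).toReal
        (C₀ ^ (1 / r) * (eLpNorm φ (ENNReal.ofReal r) volume).toReal * t ^ (-(β / r)))))
      (by fun_prop) (fun t _ => le_rfl) fun t ht => ?_
    rw [sub_self, ENNReal.rpow_zero, mul_one]
    set A := (eLpNorm φ ⊤ volume).toReal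
    set B := (eLpNorm φ (ENNReal.ofReal r) volume).toReal
    have hA0 : 0 ≤ A := ENNReal.toReal_nonneg
    have hB0 : 0 ≤ B := ENNReal.toReal_nonneg
    by_cases hAB0 : A = 0 ∨ B = 0
    · have hz : ∀ s ∈ Ioo (0 : ℝ) t, ENNReal.ofReal
          (min A (C₀ ^ (1 / r) * B * s ^ (-(β / r)))) ^ (p - 1) = 0 := by
        intro s hs
        have hs0 := hs.1.le
        rw [ENNReal.ofReal_of_nonpos, ENNReal.zero_rpow_of_pos hp10]
        rcases hAB0 with h | h
        · exact (min_le_left _ _).trans h.le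
        · exact (min_le_right _ _).trans (by simp [h])
      rw [setLIntegral_congr_fun measurableSet_Ioo hz]
      simp
    · push Not at hAB0
      have hApos : 0 < A := hA0.lt_of_ne' hAB0.1
      have hBpos : 0 < B := hB0.lt_of_ne' hAB0.2
      refine subcritical_smallness hp1 (by positivity) hγp hApos (by positivity) ?_ t
      refine le_of_eq_of_le ?_ (hδle _ (by positivity) hAB)
      have hkey : A ^ (p - 1) * (C₀ ^ (1 / r) * B / A) ^ (β / r)⁻¹ =
          C₀ ^ (1 / β) * (B ^ (r / rs) * A ^ (1 - r / rs)) ^ (p - 1) := by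
        have e1 : 1 / r * (r / β) = 1 / β := by field_simp
        have e2 : r / rs * (p - 1) = r / β := by rw [hrsβ]; field_simp
        have e3 : (1 - r / rs) * (p - 1) = (p - 1) - r / β := by rw [← e2]; ring
        rw [inv_div, div_rpow (by positivity) hA0, mul_rpow (by positivity) hB0,
          mul_rpow (by positivity) (by positivity), ← rpow_mul hC₀.le, ← rpow_mul hB0,
          ← rpow_mul hA0, e1, e2, e3, rpow_sub hApos (p - 1) (r / β)]
        ring
      rw [hkey]
      ring
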